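/- arXiv:1711.10533 — 2 statements merged into one kernel-verified Lean document; each statement's English description precedes it below -/
import Mathlib

section
/- Uniform bound on the gradient of the reciprocal: if u is a positive classical solution of u_t = ν (u^{-2} u_s)_s + f(s) on (0,1) × (0,∞) with Neumann boundary conditions u_s(0,t) = u_s(1,t) = 0 and initial data u₀, then there exists a constant C, depending only on ν, f, and the initial data, such that ∫₀¹ ((∂/∂s)(1/u))(s,t)² ds ≤ C for all t ≥ 0. -/
open MeasureTheory intervalIntegral Real

open scoped ContDiff

/-- Directional derivatives of smooth functions are smooth. -/
lemma contDiff_fderiv_apply {E : Type*} [NormedAddCommGroup E] [NormedSpace ℝ E]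
    {W : E → ℝ} (hW : ContDiff ℝ ∞ W) (v : E) :
    ContDiff ℝ ∞ (fun p => fderiv ℝ W p v) :=
  (hW.fderiv_right (m := ∞) le_rfl).clm_apply contDiff_const

lemma hasDerivAt_fst_slice {W : ℝ × ℝ → ℝ} (hW : ContDiff ℝ ∞ W) (s t : ℝ) :
    HasDerivAt (fun y => W (y, t)) (fderiv ℝ W (s, t) (1, 0)) s :=
  ((hW.differentiable (by simp)) (s, t)).hasFDerivAt.comp_hasDerivAt s
    ((hasDerivAt_id s).prodMk (hasDerivAt_const s t))

lemma hasDerivAt_snd_slice {W : ℝ × ℝ → ℝ} (hW : ContDiff ℝ ∞ W) (s t : ℝ) :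
    HasDerivAt (fun τ => W (s, τ)) (fderiv ℝ W (s, t) (0, 1)) t :=
  ((hW.differentiable (by simp)) (s, t)).hasFDerivAt.comp_hasDerivAt t
    ((hasDerivAt_const t s).prodMk (hasDerivAt_id t))

/-- Directional derivatives of smooth functions commute. -/
lemma fderiv_fderiv_apply_comm {E : Type*} [NormedAddCommGroup E] [NormedSpace ℝ E]
    {W : E → ℝ} (hW : ContDiff ℝ ∞ W) (v w p : E) :
    fderiv ℝ (fun q => fderiv ℝ W q v) p w = fderiv ℝ (fun q => fderiv ℝ W q w) p v := by
  have hd : DifferentiableAt ℝ (fderiv ℝ W) p :=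
    (hW.fderiv_right (m := ∞) le_rfl).differentiable (by simp) p
  have key : ∀ a b : E, fderiv ℝ (fun q => fderiv ℝ W q a) p b
      = fderiv ℝ (fderiv ℝ W) p b a := fun a b => by
    rw [fderiv_clm_apply hd (differentiableAt_const a)]
    simp
  have hsymm : IsSymmSndFDerivAt ℝ W p := hW.contDiffAt.isSymmSndFDerivAt (by
    rw [minSmoothness_of_isRCLikeNormedField]
    exact WithTop.coe_le_coe.2 le_top)
  rw [key, key]
  exact hsymm w v

/-- Differentiation under the integral sign when the integrand and its time derivative are
jointly continuous. -/
lemma hasDerivAt_intervalIntegral_of_continuous {G G' : ℝ → ℝ → ℝ}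
    (hG : Continuous (Function.uncurry G)) (hG' : Continuous (Function.uncurry G'))
    (h : ∀ s t, HasDerivAt (fun τ => G τ s) (G' t s) t) (a b t : ℝ) :
    HasDerivAt (fun τ => ∫ s in a..b, G τ s) (∫ s in a..b, G' t s) t := by
  have hGc : ∀ τ, Continuous (G τ) := fun τ => hG.comp (Continuous.prodMk_right τ)
  have hGc' : ∀ τ, Continuous (G' τ) := fun τ => hG'.comp (Continuous.prodMk_right τ)
  obtain ⟨C, hC⟩ := ((isCompact_closedBall t 1).prod (isCompact_uIcc (a := a) (b := b))
    ).exists_bound_of_continuousOn hG'.continuousOn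
  refine (hasDerivAt_integral_of_dominated_loc_of_deriv_le (bound := fun _ => C)
    (Metric.closedBall_mem_nhds t one_pos)
    (Filter.Eventually.of_forall fun τ => (hGc τ).aestronglyMeasurable)
    ((hGc t).intervalIntegrable a b) (hGc' t).aestronglyMeasurable
    (Filter.Eventually.of_forall fun s hs τ hτ => ?_) intervalIntegrable_const
    (Filter.Eventually.of_forall fun s _ τ _ => h s τ)).2
  exact hC (τ, s) ⟨hτ, Set.uIoc_subset_uIcc hs⟩

/-- The energy `∫₀¹ (ν/2 W_s² + g W)` decreases along any smooth Neumann evolution which moves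
against its variational derivative `g - ν W_ss`. -/
lemma antitoneOn_neumann_energy (ν : ℝ) {g : ℝ → ℝ} (hg : Continuous g)
    {W : ℝ × ℝ → ℝ} (hW : ContDiff ℝ ∞ W)
    (bc : ∀ t : ℝ, 0 ≤ t → fderiv ℝ W (0, t) (1, 0) = 0 ∧ fderiv ℝ W (1, t) (1, 0) = 0)
    (hdesc : ∀ s ∈ Set.Ioo (0 : ℝ) 1, ∀ t : ℝ, 0 < t →
      (g s - ν * fderiv ℝ (fun q => fderiv ℝ W q (1, 0)) (s, t) (1, 0))
        * fderiv ℝ W (s, t) (0, 1) ≤ 0) :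
    AntitoneOn (fun t => ∫ s in (0 : ℝ)..1,
      (ν / 2 * fderiv ℝ W (s, t) (1, 0) ^ 2 + g s * W (s, t))) (Set.Ici 0) := by
  set P : ℝ × ℝ → ℝ := fun q => fderiv ℝ W q (1, 0) with hPdef
  set Q : ℝ × ℝ → ℝ := fun q => fderiv ℝ W q (0, 1) with hQdef
  have hP : ContDiff ℝ ∞ P := contDiff_fderiv_apply hW _
  have hQ : ContDiff ℝ ∞ Q := contDiff_fderiv_apply hW _
  have hcW := hW.continuous
  have hcP := hP.continuous
  have hcQ := hQ.continuous
  have hcPs := (contDiff_fderiv_apply hP (1, 0)).continuous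
  have hcPt := (contDiff_fderiv_apply hP (0, 1)).continuous
  have hderiv : ∀ t, HasDerivAt
      (fun τ => ∫ s in (0 : ℝ)..1, (ν / 2 * P (s, τ) ^ 2 + g s * W (s, τ)))
      (∫ s in (0 : ℝ)..1, (ν * (P (s, t) * fderiv ℝ P (s, t) (0, 1)) + g s * Q (s, t))) t := by
    intro t
    refine hasDerivAt_intervalIntegral_of_continuous
      (G := fun τ s => ν / 2 * P (s, τ) ^ 2 + g s * W (s, τ))
      (G' := fun τ s => ν * (P (s, τ) * fderiv ℝ P (s, τ) (0, 1)) + g s * Q (s, τ))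
      ?_ ?_ (fun s τ => ?_) 0 1 t
    · simp only [Function.uncurry_def]
      fun_prop
    · simp only [Function.uncurry_def]
      have : Continuous fun x : ℝ × ℝ => fderiv ℝ P (x.2, x.1) (0, 1) :=
        hcPt.comp continuous_swap
      fun_prop
    · refine ((((hasDerivAt_snd_slice hP s τ).fun_pow 2).const_mul (ν / 2)).fun_add
        ((hasDerivAt_snd_slice hW s τ).const_mul (g s))).congr_deriv ?_
      simp only [hQdef]
      ring
  refine antitoneOn_of_deriv_nonpos (convex_Ici 0)
    (fun t _ => (hderiv t).continuousAt.continuousWithinAt)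
    (fun t _ => (hderiv t).differentiableAt.differentiableWithinAt) fun t ht => ?_
  rw [interior_Ici, Set.mem_Ioi] at ht
  rw [(hderiv t).deriv]
  have hsec : ∀ {H : ℝ × ℝ → ℝ}, Continuous H → Continuous fun s => H (s, t) :=
    fun hH => hH.comp (Continuous.prodMk_left t)
  have hcPs' := hsec hcPs
  have hcPt' := hsec hcPt
  have hcP' := hsec hcP
  have hcQ' := hsec hcQ
  have hparts : ∫ s in (0 : ℝ)..1, P (s, t) * fderiv ℝ P (s, t) (0, 1)
      = - ∫ s in (0 : ℝ)..1, fderiv ℝ P (s, t) (1, 0) * Q (s, t) := by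
    have hcomm : ∀ s, fderiv ℝ P (s, t) (0, 1) = fderiv ℝ Q (s, t) (1, 0) :=
      fun s => fderiv_fderiv_apply_comm hW _ _ _
    rw [integral_mul_deriv_eq_deriv_mul (fun s _ => hasDerivAt_fst_slice hP s t)
      (v := fun s => Q (s, t))
      (fun s _ => (hcomm s).symm ▸ hasDerivAt_fst_slice hQ s t)
      (hcPs'.intervalIntegrable _ _) (hcPt'.intervalIntegrable _ _)]
    have h0 : P (0, t) = 0 := (bc t ht.le).1
    have h1 : P (1, t) = 0 := (bc t ht.le).2
    rw [h0, h1]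
    ring
  rw [integral_add ((by fun_prop : Continuous _).intervalIntegrable _ _)
    ((by fun_prop : Continuous _).intervalIntegrable _ _), intervalIntegral.integral_const_mul, hparts,
    mul_neg, ← intervalIntegral.integral_const_mul, ← intervalIntegral.integral_neg, ← integral_add
    ((by fun_prop : Continuous _).intervalIntegrable _ _)
    ((by fun_prop : Continuous _).intervalIntegrable _ _)]
  calc _ ≤ ∫ _ in (0 : ℝ)..1, (0 : ℝ) := by
        refine integral_mono_on_of_le_Ioo zero_le_one
          ((by fun_prop : Continuous _).intervalIntegrable _ _)
          intervalIntegrable_const fun s hs => ?_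
        have := hdesc s hs t ht
        linarith
    _ = 0 := by simp

/-- A mean-zero bounded potential is controlled by the Dirichlet energy. -/
lemma dirichlet_le_energy {ν F : ℝ} (hν : 0 < ν) (hF : 0 ≤ F) {g w w' : ℝ → ℝ}
    (hg : Continuous g) (hgF : ∀ s ∈ Set.Ioo (0 : ℝ) 1, |g s| ≤ F)
    (hg0 : ∫ s in (0 : ℝ)..1, g s = 0)
    (hw : ∀ s, HasDerivAt w (w' s) s) (hw' : Continuous w') :
    ν / 4 * (∫ s in (0 : ℝ)..1, w' s ^ 2) - F ^ 2 / ν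
      ≤ ∫ s in (0 : ℝ)..1, (ν / 2 * w' s ^ 2 + g s * w s) := by
  have hcw : Continuous w := continuous_iff_continuousAt.2 fun s => (hw s).continuousAt
  have hint : ∀ {h : ℝ → ℝ}, Continuous h → ∀ a b : ℝ, IntervalIntegrable h volume a b :=
    fun hh a b => hh.intervalIntegrable a b
  set X := ∫ s in (0 : ℝ)..1, w' s ^ 2
  have hosc : ∀ s ∈ Set.Ioo (0 : ℝ) 1, F * |w s - w 0| ≤ ν / 4 * X + F ^ 2 / ν := by
    intro s hs
    have h1 : w s - w 0 = ∫ y in (0 : ℝ)..s, w' y :=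
      (integral_eq_sub_of_hasDerivAt (fun y _ => hw y) (hint hw' _ _)).symm
    have h2 : |w s - w 0| ≤ ∫ y in (0 : ℝ)..1, |w' y| := by
      rw [h1]
      refine (abs_integral_le_integral_abs hs.1.le).trans ?_
      exact integral_mono_interval le_rfl hs.1.le hs.2.le
        (Filter.Eventually.of_forall fun y => abs_nonneg (w' y)) (hint hw'.abs _ _)
    calc F * |w s - w 0| ≤ F * ∫ y in (0 : ℝ)..1, |w' y| := by gcongr
      _ = ∫ y in (0 : ℝ)..1, F * |w' y| := by rw [intervalIntegral.integral_const_mul]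
      _ ≤ ∫ y in (0 : ℝ)..1, (ν / 4 * w' y ^ 2 + F ^ 2 / ν) := by
          refine integral_mono_on zero_le_one (hint (by fun_prop) _ _)
            (hint (by fun_prop) _ _) fun y _ => ?_
          have : ν / 4 * w' y ^ 2 + F ^ 2 / ν - F * |w' y|
              = (ν * |w' y| / 2 - F) ^ 2 / ν := by
            rw [← sq_abs (w' y)]
            field_simp
            ring
          have := div_nonneg (sq_nonneg (ν * |w' y| / 2 - F)) hν.le
          linarith
      _ = ν / 4 * X + F ^ 2 / ν := by
          rw [integral_add (hint (by fun_prop) _ _) (hint (by fun_prop) _ _),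
            intervalIntegral.integral_const_mul]
          simp [X]
  have hpot : -(ν / 4 * X + F ^ 2 / ν) ≤ ∫ s in (0 : ℝ)..1, g s * w s := by
    have hshift : ∫ s in (0 : ℝ)..1, g s * w s = ∫ s in (0 : ℝ)..1, g s * (w s - w 0) := by
      simp_rw [mul_sub]
      rw [integral_sub (hint (by fun_prop) _ _) (hint (by fun_prop) _ _),
        intervalIntegral.integral_mul_const, hg0]
      ring
    rw [hshift]
    calc -(ν / 4 * X + F ^ 2 / ν)
        = ∫ _ in (0 : ℝ)..1, -(ν / 4 * X + F ^ 2 / ν) := by simp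
      _ ≤ _ := by
          refine integral_mono_on_of_le_Ioo zero_le_one intervalIntegrable_const
            (hint (by fun_prop) _ _) fun s hs => ?_
          have h1 : |g s * (w s - w 0)| ≤ F * |w s - w 0| := by
            rw [abs_mul]
            exact mul_le_mul_of_nonneg_right (hgF s hs) (abs_nonneg _)
          linarith [neg_abs_le (g s * (w s - w 0)), hosc s hs]
  rw [integral_add (hint (by fun_prop) _ _) (hint (by fun_prop) _ _), intervalIntegral.integral_const_mul]
  linarith

/-- The reciprocal of a positive solution satisfies `f - ν w_ss = -w_t / w²`. -/
lemma reciprocal_equation {ν : ℝ} {f : ℝ → ℝ} {u : ℝ → ℝ → ℝ}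
    (hu : ContDiff ℝ ∞ (fun p : ℝ × ℝ => u p.1 p.2)) (hupos : ∀ s t : ℝ, 0 < u s t)
    (hw : ContDiff ℝ ∞ (fun p : ℝ × ℝ => (u p.1 p.2)⁻¹)) {s t : ℝ}
    (pde : deriv (fun τ => u s τ) t =
      ν * deriv (fun y => deriv (fun z => u z t) y / (u y t) ^ 2) s + f s) :
    f s - ν * fderiv ℝ (fun q => fderiv ℝ (fun p : ℝ × ℝ => (u p.1 p.2)⁻¹) q (1, 0))
        (s, t) (1, 0)
      = -(u s t ^ 2 * fderiv ℝ (fun p : ℝ × ℝ => (u p.1 p.2)⁻¹) (s, t) (0, 1)) := by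
  have hflux : (fun y => deriv (fun z => u z t) y / (u y t) ^ 2)
      = fun y => -fderiv ℝ (fun p : ℝ × ℝ => (u p.1 p.2)⁻¹) (y, t) (1, 0) := by
    funext y
    have h := (hasDerivAt_fst_slice hu y t).fun_inv (hupos y t).ne'
    rw [← h.unique (hasDerivAt_fst_slice hw y t), (hasDerivAt_fst_slice hu y t).deriv]
    ring
  have hs := (hasDerivAt_fst_slice (contDiff_fderiv_apply hw (1, 0)) s t).fun_neg
  have ht := ((hasDerivAt_snd_slice hu s t).fun_inv (hupos s t).ne').unique
    (hasDerivAt_snd_slice hw s t)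
  rw [hflux, hs.deriv, (hasDerivAt_snd_slice hu s t).deriv] at pde
  rw [← ht, pde]
  have := (hupos s t).ne'
  field_simp
  ring

/-- Uniform bound on the gradient of the reciprocal for the
super-fast-diffusion-type equation `u_t = ν (u^{-2} u_s)_s + f(s)` with
Neumann boundary conditions: there exists a constant `C` with
`∫₀¹ ((∂/∂s)(1/u))² ds ≤ C` for all `t ≥ 0`. -/
theorem superfast_diffusion_reciprocal_gradient_bound
    (ν : ℝ) (hν : 0 < ν)
    (f : ℝ → ℝ) (F : ℝ) (hf : ∀ s ∈ Set.Icc (0:ℝ) 1, |f s| ≤ F)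
    (hfint : ∫ s in (0:ℝ)..1, f s = 0)
    (u : ℝ → ℝ → ℝ)
    (hu : ContDiff ℝ (⊤ : ℕ∞) (fun p : ℝ × ℝ => u p.1 p.2))
    (hupos : ∀ s t : ℝ, 0 < u s t)
    (pde : ∀ s ∈ Set.Ioo (0:ℝ) 1, ∀ t : ℝ, 0 < t →
      deriv (fun τ => u s τ) t =
        ν * deriv (fun y => deriv (fun z => u z t) y / (u y t)^2) s + f s)
    (bc : ∀ t : ℝ, 0 ≤ t →
      deriv (fun y => u y t) 0 = 0 ∧ deriv (fun y => u y t) 1 = 0)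
    (hmass : ∫ s in (0:ℝ)..1, u s 0 = 1) :
    ∃ C : ℝ, ∀ t : ℝ, 0 ≤ t →
      ∫ s in (0:ℝ)..1, (deriv (fun y => (u y t)⁻¹) s)^2 ≤ C := by
  have hw : ContDiff ℝ ∞ (fun p : ℝ × ℝ => (u p.1 p.2)⁻¹) :=
    hu.inv fun p => (hupos p.1 p.2).ne'
  have hF : 0 ≤ F := (abs_nonneg _).trans (hf 0 (by simp))
  have hrec := fun s hs t ht => reciprocal_equation hu hupos hw (pde s hs t ht)
  set W : ℝ × ℝ → ℝ := fun p => (u p.1 p.2)⁻¹ with hWdef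
  have hWs := contDiff_fderiv_apply hw (1, 0)
  have hsec : ∀ {H : ℝ × ℝ → ℝ}, Continuous H → ∀ t, Continuous fun s => H (s, t) :=
    fun hH t => hH.comp (Continuous.prodMk_left t)
  -- On the open interval the source agrees with a continuous function.
  obtain ⟨g, hg, hgf⟩ : ∃ g : ℝ → ℝ, Continuous g ∧ ∀ s ∈ Set.Ioo (0 : ℝ) 1, g s = f s := by
    refine ⟨fun s => ν * fderiv ℝ (fun q => fderiv ℝ W q (1, 0)) (s, 1) (1, 0)
      - u s 1 ^ 2 * fderiv ℝ W (s, 1) (0, 1), ?_, fun s hs => ?_⟩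
    · have h1 := hsec (contDiff_fderiv_apply hWs (1, 0)).continuous 1
      have h2 := hsec (contDiff_fderiv_apply hw (0, 1)).continuous 1
      have h3 : Continuous fun s => u s 1 := hsec hu.continuous 1
      fun_prop
    · have := hrec s hs 1 one_pos
      linarith
  have hg0 : ∫ s in (0 : ℝ)..1, g s = 0 :=
    (integral_congr_Ioo_of_le zero_le_one hgf).trans hfint
  have hgF : ∀ s ∈ Set.Ioo (0 : ℝ) 1, |g s| ≤ F := fun s hs => by
    rw [hgf s hs]
    exact hf s (Set.Ioo_subset_Icc_self hs)
  have hslope : ∀ t s, fderiv ℝ W (s, t) (1, 0)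
      = -deriv (fun y => u y t) s / u s t ^ 2 := fun t s => by
    have h := hasDerivAt_fst_slice hu s t
    rw [← (h.fun_inv (hupos s t).ne').unique (hasDerivAt_fst_slice hw s t), h.deriv]
  have hanti := antitoneOn_neumann_energy ν hg hw
    (fun t ht => by simp [hslope, (bc t ht).1, (bc t ht).2])
    (fun s hs t ht => by
      rw [hgf s hs, hrec s hs t ht, neg_mul, mul_assoc]
      exact neg_nonpos.2 (mul_nonneg (sq_nonneg _) (mul_self_nonneg _)))
  refine ⟨4 / ν * ((∫ s in (0 : ℝ)..1,
    (ν / 2 * fderiv ℝ W (s, 0) (1, 0) ^ 2 + g s * W (s, 0))) + F ^ 2 / ν), fun t ht => ?_⟩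
  have hE := hanti (Set.mem_Ici.2 le_rfl) (Set.mem_Ici.2 ht) ht
  have hlow := dirichlet_le_energy hν hF hg hgF hg0 (fun s => hasDerivAt_fst_slice hw s t)
    (hsec hWs.continuous t)
  have hderiv : ∀ s, deriv (fun y => (u y t)⁻¹) s = fderiv ℝ W (s, t) (1, 0) :=
    fun s => (hasDerivAt_fst_slice hw s t).deriv
  simp_rw [hderiv]
  rw [div_mul_eq_mul_div, le_div_iff₀ hν]
  simp only at hE
  linarith
end

section
/- Radial energy inequality (Lemma A.1, first part): for any smooth solution of the radially symmetric viscous sheet system with the stated boundary conditions and h > 0, for every t > 0, d/dt ∫₀¹ [ (h v²)/2 + σ h_r²/2 ] r dr ≤ −2μ ∫₀¹ h ((∂/∂r)(v r))² / r dr. -/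
open MeasureTheory intervalIntegral Real

/-- The coordinate derivatives of a smooth function on the plane are smooth. -/
lemma exists_contDiff_partial_derivatives {f : ℝ → ℝ → ℝ}
    (hf : ContDiff ℝ (⊤ : ℕ∞) (fun p : ℝ × ℝ => f p.1 p.2)) :
    ∃ f₁ f₂ f₁₂ : ℝ → ℝ → ℝ,
      ContDiff ℝ (⊤ : ℕ∞) (fun p : ℝ × ℝ => f₁ p.1 p.2) ∧
      ContDiff ℝ (⊤ : ℕ∞) (fun p : ℝ × ℝ => f₂ p.1 p.2) ∧
      ContDiff ℝ (⊤ : ℕ∞) (fun p : ℝ × ℝ => f₁₂ p.1 p.2) ∧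
      (∀ x y, HasDerivAt (fun s => f s y) (f₁ x y) x) ∧
      (∀ x y, HasDerivAt (fun s => f x s) (f₂ x y) y) ∧
      (∀ x y, HasDerivAt (fun s => f₁ x s) (f₁₂ x y) y) ∧
      (∀ x y, HasDerivAt (fun s => f₂ s y) (f₁₂ x y) x) := by
  set F : ℝ × ℝ → ℝ := fun p => f p.1 p.2
  have hF' : ContDiff ℝ (⊤ : ℕ∞) (fderiv ℝ F) := hf.fderiv_right (by simp)
  have hF'' : ContDiff ℝ (⊤ : ℕ∞) (fderiv ℝ (fderiv ℝ F)) := hF'.fderiv_right (by simp)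
  have line₁ (x y : ℝ) : HasDerivAt (fun s : ℝ => (s, y)) ((1, 0) : ℝ × ℝ) x :=
    (hasDerivAt_id x).prodMk (hasDerivAt_const x y)
  have line₂ (x y : ℝ) : HasDerivAt (fun s : ℝ => (x, s)) ((0, 1) : ℝ × ℝ) y :=
    (hasDerivAt_const y x).prodMk (hasDerivAt_id y)
  have hd (p : ℝ × ℝ) : HasFDerivAt F (fderiv ℝ F p) p :=
    (hf.differentiable (by simp) p).hasFDerivAt
  have hd' (p w : ℝ × ℝ) :
      HasFDerivAt (fun q => fderiv ℝ F q w) ((fderiv ℝ (fderiv ℝ F) p).flip w) p :=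
    (ContinuousLinearMap.apply ℝ ℝ w).hasFDerivAt.comp p
      (hF'.differentiable (by simp) p).hasFDerivAt
  have hsymm (p : ℝ × ℝ) : IsSymmSndFDerivAt ℝ F p :=
    hf.contDiffAt.isSymmSndFDerivAt
      (by
        rw [minSmoothness_of_isRCLikeNormedField]
        exact WithTop.coe_le_coe.2 (le_top : (2 : ℕ∞) ≤ ⊤))
  refine ⟨fun x y => fderiv ℝ F (x, y) (1, 0), fun x y => fderiv ℝ F (x, y) (0, 1),
    fun x y => fderiv ℝ (fderiv ℝ F) (x, y) (0, 1) (1, 0),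
    hF'.clm_apply contDiff_const, hF'.clm_apply contDiff_const,
    (hF''.clm_apply contDiff_const).clm_apply contDiff_const,
    fun x y => (hd (x, y)).comp_hasDerivAt (f := fun s => (s, y)) x (line₁ x y),
    fun x y => (hd (x, y)).comp_hasDerivAt (f := fun s => (x, s)) y (line₂ x y),
    fun x y => (hd' (x, y) (1, 0)).comp_hasDerivAt (f := fun s => (x, s)) y (line₂ x y),
    fun x y => ?_⟩
  refine ((hd' (x, y) (0, 1)).comp_hasDerivAt (f := fun s => (s, y)) x
    (line₁ x y)).congr_deriv ?_
  exact hsymm (x, y) (1, 0) (0, 1)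

/-- Differentiation under the integral sign for a jointly continuous derivative. -/
lemma hasDerivAt_intervalIntegral_of_continuous_s17 {e e' : ℝ → ℝ → ℝ} {a b : ℝ}
    (he : Continuous fun p : ℝ × ℝ => e p.1 p.2)
    (he' : Continuous fun p : ℝ × ℝ => e' p.1 p.2)
    (hderiv : ∀ r t, HasDerivAt (fun τ => e r τ) (e' r t) t) (t : ℝ) :
    HasDerivAt (fun τ => ∫ r in a..b, e r τ) (∫ r in a..b, e' r t) t := by
  have hslice (τ : ℝ) : Continuous fun r => e r τ :=
    he.comp (continuous_id.prodMk continuous_const)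
  have hslice' : Continuous fun r => e' r t :=
    he'.comp (continuous_id.prodMk continuous_const)
  obtain ⟨C, hC⟩ := (isCompact_uIcc.prod (isCompact_closedBall t 1) :
    IsCompact (Set.uIcc a b ×ˢ Metric.closedBall t 1)).exists_bound_of_continuousOn
      he'.continuousOn
  refine (hasDerivAt_integral_of_dominated_loc_of_deriv_le (F := fun τ r => e r τ)
    (F' := fun τ r => e' r τ) (bound := fun _ => C) (Metric.closedBall_mem_nhds t one_pos)
    (.of_forall fun τ => (hslice τ).aestronglyMeasurable) ((hslice t).intervalIntegrable a b)
    hslice'.aestronglyMeasurable (.of_forall fun r hr τ hτ => ?_) (by simp)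
    (.of_forall fun r _ τ _ => hderiv r τ)).2
  exact hC (r, τ) ⟨Set.uIoc_subset_uIcc hr, hτ⟩

/-- Radial energy inequality (Lemma A.1, first part): for any smooth solution
of the radially symmetric viscous sheet system
`v_t + v v_r = σ ((1/r)(r h_r)_r)_r + (4μ/h)([(h/r)(r v)_r]_r − v h_r/(2r))`,
`h_t = −(r h v)_r / r` on `(0,1) × (0,∞)` with the stated boundary conditions
and `h > 0`, for every `t > 0`,
`d/dt ∫₀¹ [(h v²)/2 + σ h_r²/2] r dr ≤ −2μ ∫₀¹ h ((∂/∂r)(v r))² / r dr`. -/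
theorem radial_energy_inequality
    (σ μ : ℝ) (hσ : 0 < σ) (hμ : 0 < μ)
    (h v : ℝ → ℝ → ℝ)
    (hh : ContDiff ℝ (⊤ : ℕ∞) (fun p : ℝ × ℝ => h p.1 p.2))
    (hv : ContDiff ℝ (⊤ : ℕ∞) (fun p : ℝ × ℝ => v p.1 p.2))
    (hpos : ∀ r t : ℝ, 0 < h r t)
    (momentum : ∀ r ∈ Set.Ioo (0:ℝ) 1, ∀ t : ℝ, 0 < t →
      deriv (fun τ => v r τ) t + v r t * deriv (fun ρ => v ρ t) r =
        σ * deriv (fun ρ => (deriv (fun y => y * deriv (fun z => h z t) y) ρ) / ρ) r +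
          (4 * μ / h r t) *
            (deriv (fun ρ => (h ρ t / ρ) * deriv (fun y => y * v y t) ρ) r -
              v r t * deriv (fun y => h y t) r / (2 * r)))
    (continuity : ∀ r ∈ Set.Ioo (0:ℝ) 1, ∀ t : ℝ, 0 < t →
      deriv (fun τ => h r τ) t = -(deriv (fun ρ => ρ * h ρ t * v ρ t) r) / r)
    (bch : ∀ t : ℝ, 0 ≤ t →
      deriv (fun ρ => h ρ t) 0 = 0 ∧ deriv (fun ρ => h ρ t) 1 = 0)
    (bcv : ∀ t : ℝ, 0 ≤ t → v 0 t = 0 ∧ v 1 t = 0) :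
    ∀ t : ℝ, 0 < t → ∃ D : ℝ,
      HasDerivAt (fun τ => ∫ r in (0:ℝ)..1,
          (h r τ * (v r τ)^2 / 2 + σ * (deriv (fun ρ => h ρ τ) r)^2 / 2) * r) D t ∧
      D ≤ -(2 * μ * ∫ r in (0:ℝ)..1,
          h r t * (deriv (fun ρ => v ρ t * ρ) r)^2 / r) := by
  intro t ht
  obtain ⟨hr, ht', hrt, hr_smooth, ht_smooth, hrt_smooth, d_h, d_ht, d_hrt, d_htr⟩ :=
    exists_contDiff_partial_derivatives hh
  obtain ⟨vr, vt, -, vr_smooth, vt_smooth, -, d_v, d_vt, -, -⟩ :=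
    exists_contDiff_partial_derivatives hv
  obtain ⟨hrr, -, -, hrr_smooth, -, -, d_hr, -, -, -⟩ :=
    exists_contDiff_partial_derivatives hr_smooth
  obtain ⟨hrrr, -, -, hrrr_smooth, -, -, d_hrr, -, -, -⟩ :=
    exists_contDiff_partial_derivatives hrr_smooth
  obtain ⟨vrr, -, -, vrr_smooth, -, -, d_vr, -, -, -⟩ :=
    exists_contDiff_partial_derivatives vr_smooth
  have slice {f : ℝ → ℝ → ℝ} (hf : ContDiff ℝ (⊤ : ℕ∞) (fun p : ℝ × ℝ => f p.1 p.2)) :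
      Continuous fun r => f r t :=
    hf.continuous.comp (continuous_id.prodMk continuous_const)
  have d_id (r : ℝ) : HasDerivAt (fun ρ : ℝ => ρ) 1 r := hasDerivAt_id r
  have deriv_h (r τ : ℝ) : deriv (fun ρ => h ρ τ) r = hr r τ := (d_h r τ).deriv
  have deriv_rv (r : ℝ) : deriv (fun y => y * v y t) r = v r t + r * vr r t := by
    refine (((d_id r).mul (d_v r t)).congr_deriv ?_).deriv
    ring
  have deriv_vr (r : ℝ) : deriv (fun ρ => v ρ t * ρ) r = v r t + r * vr r t := by
    refine (((d_v r t).mul (d_id r)).congr_deriv ?_).deriv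
    ring
  have deriv_rhr (r : ℝ) : deriv (fun y => y * hr y t) r = hr r t + r * hrr r t := by
    refine (((d_id r).mul (d_hr r t)).congr_deriv ?_).deriv
    ring
  simp only [deriv_h, deriv_vr]
  have mass : ∀ r ∈ Set.Ioo (0:ℝ) 1,
      r * ht' r t = -(h r t * v r t + r * hr r t * v r t + r * h r t * vr r t) := by
    intro r hr0
    have hr_ne : r ≠ 0 := hr0.1.ne'
    have deriv_flow : deriv (fun ρ => ρ * h ρ t * v ρ t) r =
        h r t * v r t + r * hr r t * v r t + r * h r t * vr r t := by
      refine ((((d_id r).mul (d_h r t)).mul (d_v r t)).congr_deriv ?_).deriv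
      simp only [Pi.mul_apply]
      ring
    have := continuity r hr0 t ht
    rw [(d_ht r t).deriv, deriv_flow] at this
    rw [this]
    field_simp
  have mom : ∀ r ∈ Set.Ioo (0:ℝ) 1, vt r t + v r t * vr r t =
      σ * (((2 * hrr r t + r * hrrr r t) * r - (hr r t + r * hrr r t)) / r ^ 2) +
        (4 * μ / h r t) * (((hr r t * r - h r t) / r ^ 2 * (v r t + r * vr r t) +
          h r t / r * (2 * vr r t + r * vrr r t)) - v r t * hr r t / (2 * r)) := by
    intro r hr0
    have hr_ne : r ≠ 0 := hr0.1.ne'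
    have deriv_curvature : deriv (fun ρ => (hr ρ t + ρ * hrr ρ t) / ρ) r =
        ((2 * hrr r t + r * hrrr r t) * r - (hr r t + r * hrr r t)) / r ^ 2 := by
      refine ((((d_hr r t).add ((d_id r).mul (d_hrr r t))).div (d_id r) hr_ne).congr_deriv
        ?_).deriv
      simp only [Pi.add_apply, Pi.mul_apply]
      ring
    have deriv_stress : deriv (fun ρ => h ρ t / ρ * (v ρ t + ρ * vr ρ t)) r =
        (hr r t * r - h r t) / r ^ 2 * (v r t + r * vr r t) +
          h r t / r * (2 * vr r t + r * vrr r t) := by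
      refine ((((d_h r t).div (d_id r) hr_ne).mul
        ((d_v r t).add ((d_id r).mul (d_vr r t)))).congr_deriv ?_).deriv
      simp only [Pi.add_apply, Pi.mul_apply, Pi.div_apply]
      ring
    have := momentum r hr0 t ht
    simp only [deriv_h, deriv_rv, deriv_rhr] at this
    rwa [(d_vt r t).deriv, (d_v r t).deriv, deriv_curvature, deriv_stress] at this
  let flux : ℝ → ℝ := fun r => -(r * h r t * v r t ^ 3 / 2) + σ * (r * hr r t * ht' r t)
    + σ * ((hr r t + r * hrr r t) * (h r t * v r t))
    + 4 * μ * (v r t * h r t * (v r t + r * vr r t)) - 2 * μ * (v r t ^ 2 * h r t)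
  let flux' : ℝ → ℝ := fun r =>
    -((h r t + r * hr r t) * v r t ^ 3 / 2 + r * h r t * (3 * v r t ^ 2 * vr r t) / 2)
    + σ * ((hr r t + r * hrr r t) * ht' r t + r * hr r t * hrt r t)
    + σ * ((2 * hrr r t + r * hrrr r t) * (h r t * v r t)
      + (hr r t + r * hrr r t) * (hr r t * v r t + h r t * vr r t))
    + 4 * μ * ((vr r t * h r t + v r t * hr r t) * (v r t + r * vr r t)
      + v r t * h r t * (2 * vr r t + r * vrr r t))
    - 2 * μ * (2 * v r t * vr r t * h r t + v r t ^ 2 * hr r t)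
  let density : ℝ → ℝ → ℝ := fun r τ =>
    (ht' r τ * v r τ ^ 2 / 2 + h r τ * v r τ * vt r τ + σ * hr r τ * hrt r τ) * r
  have c_h := slice hh
  have c_hr := slice hr_smooth
  have c_ht := slice ht_smooth
  have c_hrt := slice hrt_smooth
  have c_hrr := slice hrr_smooth
  have c_hrrr := slice hrrr_smooth
  have c_v := slice hv
  have c_vr := slice vr_smooth
  have c_vt := slice vt_smooth
  have c_vrr := slice vrr_smooth
  have flux_deriv (r : ℝ) : HasDerivAt flux (flux' r) r := by
    have hw := (d_v r t).add ((d_id r).mul (d_vr r t))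
    have hz := (d_hr r t).add ((d_id r).mul (d_hrr r t))
    have := (((((((d_id r).mul (d_h r t)).mul ((d_v r t).pow 3)).div_const 2).neg.add
      ((((d_id r).mul (d_hr r t)).mul (d_htr r t)).const_mul σ)).add
      ((hz.mul ((d_h r t).mul (d_v r t))).const_mul σ)).add
      ((((d_v r t).mul (d_h r t)).mul hw).const_mul (4 * μ))).sub
      ((((d_v r t).pow 2).mul (d_h r t)).const_mul (2 * μ))
    refine this.congr_deriv ?_
    simp only [flux', Pi.add_apply, Pi.mul_apply, Pi.pow_apply]
    push_cast
    ring
  have flux'_cont : Continuous flux' := by fun_prop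
  have density_cont : Continuous fun r => density r t := by fun_prop
  have flux_integral : ∫ r in (0:ℝ)..1, flux' r = 0 := by
    rw [integral_eq_sub_of_hasDerivAt (fun r _ => flux_deriv r)
      (flux'_cont.intervalIntegrable 0 1)]
    have b0 := bch t ht.le
    have b1 := bcv t ht.le
    simp only [deriv_h] at b0
    simp [flux, b0.1, b0.2, b1.1, b1.2]
  have energy_identity : ∀ r ∈ Set.Ioo (0:ℝ) 1, density r t =
      flux' r - 4 * μ * (h r t * (v r t + r * vr r t) ^ 2 / r)
        + 4 * μ * (h r t * v r t * vr r t) := by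
    intro r hr0
    have hr_ne : r ≠ 0 := hr0.1.ne'
    have h_ne : h r t ≠ 0 := (hpos r t).ne'
    have h_acc : vt r t = _ := eq_sub_of_add_eq (mom r hr0)
    have h_ht : ht' r t = -(h r t * v r t + r * hr r t * v r t + r * h r t * vr r t) / r := by
      rw [← mass r hr0]; field_simp
    simp only [density, flux']
    rw [h_acc, h_ht]
    field_simp
    ring
  have dissipation_integrable : IntervalIntegrable
      (fun r => h r t * (v r t + r * vr r t) ^ 2 / r) volume 0 1 := by
    have hc : Continuous fun r =>
        (flux' r - density r t) / (4 * μ) + h r t * v r t * vr r t := by fun_prop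
    refine (hc.intervalIntegrable 0 1).congr_uIoo fun r hr0 => ?_
    rw [Set.uIoo_of_le zero_le_one] at hr0
    simp only [energy_identity r hr0]
    field_simp
    ring
  refine ⟨∫ r in (0:ℝ)..1, density r t, ?_, ?_⟩
  · have := hh.continuous
    have := hv.continuous
    have := hr_smooth.continuous
    have := ht_smooth.continuous
    have := hrt_smooth.continuous
    have := vt_smooth.continuous
    refine hasDerivAt_intervalIntegral_of_continuous_s17 (by fun_prop) (by fun_prop) (fun r τ => ?_) t
    refine (((((d_ht r τ).mul ((d_vt r τ).pow 2)).div_const 2).add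
      ((((d_hrt r τ).pow 2).const_mul σ).div_const 2)).mul_const r).congr_deriv ?_
    simp only [density, Pi.pow_apply]
    push_cast
    ring
  · calc ∫ r in (0:ℝ)..1, density r t
        ≤ ∫ r in (0:ℝ)..1,
            (flux' r - 2 * μ * (h r t * (v r t + r * vr r t) ^ 2 / r)) := by
          refine integral_mono_on_of_le_Ioo zero_le_one
            (density_cont.intervalIntegrable 0 1)
            ((flux'_cont.intervalIntegrable 0 1).sub (dissipation_integrable.const_mul _))
            fun r hr0 => ?_
          have hr_pos : 0 < r := hr0.1
          have h_pos := hpos r t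
          have key : 0 ≤ 2 * μ * (h r t * (v r t ^ 2 + (r * vr r t) ^ 2) / r) := by positivity
          have expand : 2 * μ * (h r t * (v r t ^ 2 + (r * vr r t) ^ 2) / r) =
              2 * μ * (h r t * (v r t + r * vr r t) ^ 2 / r)
                - 4 * μ * (h r t * v r t * vr r t) := by
            field_simp
            ring
          rw [energy_identity r hr0]
          linarith
      _ = -(2 * μ * ∫ r in (0:ℝ)..1, h r t * (v r t + r * vr r t) ^ 2 / r) := by
          rw [integral_sub (flux'_cont.intervalIntegrable 0 1)
            (dissipation_integrable.const_mul _), flux_integral,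
            intervalIntegral.integral_const_mul, zero_sub]
end
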